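/- Suppose A, B, C, D ∈ End(ℂⁿ⊗ℂⁿ) satisfy the Yang–Baxter consistency relations and the unitarity conditions, and that A₁₂, D₁₂, B₁₂^{t₁}, C₁₂^{t₂} are invertible as well as the fused matrices A_{MN̄′}, D_{MN̄′}, B_{MN′}^{t_M}, C_{MN′}^{t_{N′}} for all disjoint ordered label sets M, N′. Let K ∈ End(V)⊗R satisfy the dual exchange relation (A₁₂⁻¹)^{t₁t₂} K₁ ((B₁₂^{t₁})⁻¹)^{t₂} K₂ = K₂ ((C₁₂^{t₂})⁻¹)^{t₁} K₁ (D₁₂^{t₁t₂})⁻¹. Define K_M := ∏→_{i∈M} ( K_i · ∏→_{j∈M, j>i} ((B_{ij}^{t_i})⁻¹)^{t_j} ). Then for all disjoint ordered label sets M, N′ the fused dual exchange relation holds: (A_{MN̄′}⁻¹)^{t_M t_{N′}} K_M ((B_{MN′}^{t_M})⁻¹)^{t_{N′}} K_{N′} = K_{N′} ((C_{MN′}^{t_{N′}})⁻¹)^{t_M} K_M (D_{MN̄′}^{t_M t_{N′}})⁻¹. -/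

import Mathlib

open Matrix

namespace QT

variable {n : ℕ} {ι : Type*} [Fintype ι] [DecidableEq ι] {α : Type*}
variable {R : Type*} [Ring R] [Algebra ℂ R]

/-- Operators on `V^{⊗ι}`, `V = ℂⁿ`, with entries in `α`. -/
abbrev Tens (ι : Type*) (n : ℕ) (α : Type*) := Matrix (ι → Fin n) (ι → Fin n) α

/-- Two-site matrices, i.e. elements of `End(V ⊗ V)` with entries in `α`. -/
abbrev M2 (n : ℕ) (α : Type*) := Matrix (Fin n × Fin n) (Fin n × Fin n) α

/-- `X_{ij}` : embedding of a two-site matrix at the (distinct) sites `i, j`,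
acting as the identity elsewhere. -/
noncomputable def emb2 [MulZeroOneClass α] (X : M2 n α) (i j : ι) : Tens ι n α :=
  Matrix.of fun f g =>
    if ∀ k, k ≠ i → k ≠ j → f k = g k then X (f i, f j) (g i, g j) else 0

/-- `T_i` : embedding of a one-site matrix at site `i`. -/
noncomputable def emb1 [Zero α] (T : Matrix (Fin n) (Fin n) α) (i : ι) : Tens ι n α :=
  Matrix.of fun f g => if ∀ k, k ≠ i → f k = g k then T (f i) (g i) else 0

/-- Fused matrix `X_{MN} = ∏→_{i∈M} ∏→_{j∈N} X_{ij}` (a bar, i.e. reversal of one of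
the ordered label sets, is obtained by passing `M.reverse` or `N.reverse`). -/
noncomputable def fuse [Semiring α] (X : M2 n α) (M N : List ι) : Tens ι n α :=
  (M.map fun i => (N.map fun j => emb2 X i j).prod).prod

/-- Partial transposition `t_S` in the factors labelled by `S`. -/
noncomputable def ptrans (S : Finset ι) (X : Tens ι n α) : Tens ι n α :=
  Matrix.of fun f g =>
    X (fun k => if k ∈ S then g k else f k) (fun k => if k ∈ S then f k else g k)

/-- Partial transposition `t₁` on a two-site matrix. -/
noncomputable def t1 (X : M2 n α) : M2 n α :=
  Matrix.of fun p q => X (q.1, p.2) (p.1, q.2)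

/-- Partial transposition `t₂` on a two-site matrix. -/
noncomputable def t2 (X : M2 n α) : M2 n α :=
  Matrix.of fun p q => X (p.1, q.2) (q.1, p.2)

/-- `X₂₁ = P X₁₂ P` : permutation of the two factors of a two-site matrix. -/
noncomputable def perm2 (X : M2 n α) : M2 n α :=
  Matrix.of fun p q => X (p.2, p.1) (q.2, q.1)

/-- The permutation (flip) matrix `P` on `V ⊗ V`. -/
noncomputable def PM (n : ℕ) (α : Type*) [Zero α] [One α] : M2 n α :=
  Matrix.of fun p q => if p.1 = q.2 ∧ p.2 = q.1 then 1 else 0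

/-- Index type for `V^{⊗M}`. -/
abbrev idx (n : ℕ) {ι : Type*} [DecidableEq ι] (M : List ι) :=
  {x // x ∈ M.toFinset} → Fin n

/-- Embedding `End(V^{⊗M}) ⊗ R → End(V^{⊗ι}) ⊗ R`, acting as the identity off `M`. -/
noncomputable def embS [Zero α] (M : List ι) (X : Matrix (idx n M) (idx n M) α) :
    Tens ι n α :=
  Matrix.of fun f g =>
    if ∀ k, k ∉ M.toFinset → f k = g k then
      X (fun i => f i.1) (fun i => g i.1) else 0

/-- A pair of disjoint ordered label sets. -/
def OkPair (M N : List ι) : Prop := M.Nodup ∧ N.Nodup ∧ M.Disjoint N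

/-- Fused solution `T_M = ∏→_{i∈M} ( T_i ∏→_{j∈M, j>i} B_{ij} )` of the quadratic
exchange algebra (also used for the dual fusion, with `B` replaced by the
appropriate dual structure matrix). -/
noncomputable def fuseT (B : M2 n ℂ) (T : Matrix (Fin n) (Fin n) R) :
    List ι → Tens ι n R
  | [] => 1
  | i :: M => emb1 T i *
      ((M.map fun j => (emb2 B i j).map (algebraMap ℂ R)).prod) * fuseT B T M

/-- The chain `X̌_{i₁i₂} X̌_{i₂i₃} ⋯ X̌_{i_{m-1}i_m}` along the ordered label set,
where `X̌_{ij} = P_{ij} X_{ij}`. -/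
noncomputable def chainCheck (X : M2 n ℂ) : List ι → Tens ι n ℂ
  | [] => 1
  | [_] => 1
  | i :: j :: M => emb2 (PM n ℂ * X) i j * chainCheck X (j :: M)

/-- The lexicographically ordered product `L_M = ∏_{i<j ∈ M} A_{ij}`. -/
noncomputable def lexA (A : M2 n ℂ) : List ι → Tens ι n ℂ
  | [] => 1
  | i :: M => (M.map fun j => emb2 A i j).prod * lexA A M

/-- DKM-type fused solution
`T̃_M = ∏→_{i∈M} ( (∏→_{j>i} A_{ij}) T_i (∏←_{j>i} B_{ij}) )`. -/
noncomputable def fuseT2 (A B : M2 n ℂ) (T : Matrix (Fin n) (Fin n) R) :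
    List ι → Tens ι n R
  | [] => 1
  | i :: M => ((M.map fun j => emb2 A i j).prod).map (algebraMap ℂ R) * emb1 T i *
      ((M.reverse.map fun j => emb2 B i j).prod).map (algebraMap ℂ R) * fuseT2 A B T M

/-! ### Dynamical setting -/

/-- the space of dynamical parameters `λ ∈ ℂⁿ`. -/
abbrev Lam (n : ℕ) := Fin n → ℂ

/-- standard basis vector `e_a` of `ℂⁿ`. -/
noncomputable def ee {n : ℕ} (a : Fin n) : Lam n := Pi.single a 1

/-- `Σ_{k∈S} e_{f k}` : the dynamical shift read off the indices at the factors in `S`. -/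
noncomputable def shL (S : Finset ι) (f : ι → Fin n) : Lam n := ∑ k ∈ S, ee (f k)

/-- The dynamical shift `X(λ + h_S)` of a matrix-valued function of `λ` (which is
assumed to act as the identity on the factors labelled by `S`). -/
noncomputable def dsh (S : Finset ι) (X : Lam n → Tens ι n α) : Lam n → Tens ι n α :=
  fun lam => Matrix.of fun f g => X (lam + shL S f) f g

/-- Dynamical structure matrices `ℂⁿ → End(V⊗V)`. -/
abbrev DSM (n : ℕ) := Lam n → M2 n ℂ

/-- Fused `A_{MN̄′}` (no dynamical shifts occur in the recursion for `A`). -/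
noncomputable def fuseAd (A : DSM n) (M N : List ι) : Lam n → Tens ι n ℂ :=
  fun lam => fuse (A lam) M N.reverse

/-- Fused `B_{MN′} = B_{1N′} ⋅ B_{M₀N′}(λ+h₁)`. -/
noncomputable def fuseBd (B : DSM n) : List ι → List ι → Lam n → Tens ι n ℂ
  | [], _ => fun _ => 1
  | i :: M, N => fun lam =>
      ((N.map fun j => emb2 (B lam) i j).prod) * dsh {i} (fuseBd B M N) lam

/-- Fused `C_{MN′} = C_{M1′} ⋅ C_{MN′₀}(λ+h_{1′})`. -/
noncomputable def fuseCd (C : DSM n) : List ι → List ι → Lam n → Tens ι n ℂ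
  | _, [] => fun _ => 1
  | M, j :: N => fun lam =>
      ((M.map fun i => emb2 (C lam) i j).prod) * dsh {j} (fuseCd C M N) lam

/-- Fused `D_{iN̄′} = D_{in′}(λ+h_{(1′,n′-1)}) ⋅ D_{i,(N̄′)₀}` (`Nr` is the reversed `N′`). -/
noncomputable def fuseD1 (D : DSM n) (i : ι) : List ι → Lam n → Tens ι n ℂ
  | [] => fun _ => 1
  | j :: Nr => fun lam =>
      dsh Nr.toFinset (fun mu => emb2 (D mu) i j) lam * fuseD1 D i Nr lam

/-- Fused `D_{MN̄′} = D_{1N̄′} ⋅ D_{M₀N̄′}(λ+h₁)`. -/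
noncomputable def fuseDd (D : DSM n) : List ι → List ι → Lam n → Tens ι n ℂ
  | [], _ => fun _ => 1
  | i :: M, N => fun lam => fuseD1 D i N.reverse lam * dsh {i} (fuseDd D M N) lam

/-- zero-weight condition on the first factor: `[B₁₂, h⊗1] = 0` for all diagonal `h`. -/
def WB (B : DSM n) : Prop := ∀ lam (d : Fin n → ℂ),
  B lam * Matrix.diagonal (fun p => d p.1) = Matrix.diagonal (fun p => d p.1) * B lam

/-- zero-weight condition on the second factor: `[C₁₂, 1⊗h] = 0` for all diagonal `h`. -/
def WC (C : DSM n) : Prop := ∀ lam (d : Fin n → ℂ),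
  C lam * Matrix.diagonal (fun p => d p.2) = Matrix.diagonal (fun p => d p.2) * C lam

/-- total zero-weight condition: `[D₁₂, h⊗1 + 1⊗h] = 0` for all diagonal `h`. -/
def WD (D : DSM n) : Prop := ∀ lam (d : Fin n → ℂ),
  D lam * Matrix.diagonal (fun p => d p.1 + d p.2)
    = Matrix.diagonal (fun p => d p.1 + d p.2) * D lam

/-- The four coupled semi-dynamical Yang–Baxter equations, on `V⊗V⊗V`. -/
def SDYB (A B C D : DSM n) : Prop :=
  (∀ lam, emb2 (ι := Fin 3) (A lam) 0 1 * emb2 (A lam) 0 2 * emb2 (A lam) 1 2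
      = emb2 (A lam) 1 2 * emb2 (A lam) 0 2 * emb2 (A lam) 0 1) ∧
  (∀ lam, dsh {2} (fun mu => emb2 (ι := Fin 3) (D mu) 0 1) lam * emb2 (D lam) 0 2 *
        dsh {0} (fun mu => emb2 (D mu) 1 2) lam
      = emb2 (D lam) 1 2 * dsh {1} (fun mu => emb2 (D mu) 0 2) lam * emb2 (D lam) 0 1) ∧
  (∀ lam, emb2 (ι := Fin 3) (D lam) 0 1 * emb2 (B lam) 0 2 *
        dsh {0} (fun mu => emb2 (B mu) 1 2) lam
      = emb2 (B lam) 1 2 * dsh {1} (fun mu => emb2 (B mu) 0 2) lam * emb2 (D lam) 0 1) ∧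
  (∀ lam, emb2 (ι := Fin 3) (A lam) 0 1 * emb2 (C lam) 0 2 * emb2 (C lam) 1 2
      = emb2 (C lam) 1 2 * emb2 (C lam) 0 2 * dsh {2} (fun mu => emb2 (A mu) 0 1) lam)

/-- Fused semi-dynamical solution
`T_M(λ) = ∏→_{i∈M} ( T_i(λ + h_{{k∈M : k<i}}) ∏→_{j∈M, j>i} B_{ij}(λ) )`. -/
noncomputable def fuseTd (B : DSM n) (T : Lam n → Matrix (Fin n) (Fin n) R)
    (M : List ι) : Lam n → Tens ι n R := fun lam =>
  (M.map fun i =>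
    dsh ((M.takeWhile (fun k => decide (k ≠ i))).toFinset)
        (fun mu => emb1 (T mu) i) lam *
    ((((M.dropWhile (fun k => decide (k ≠ i))).tail).map fun j =>
        emb2 (B lam) i j).prod).map (algebraMap ℂ R)).prod

/-- Site-labelled elements of a monoid: `x s i j` is supported on the sites `i, j` and `k i` on
the site `i`; the members `a`, `b`, `d` of the family `x` together with `k` satisfy a quadratic
exchange relation and its consistency relations. -/
structure ExchangeData {τ ι 𝓜 : Type*} [Monoid 𝓜] (x : τ → ι → ι → 𝓜) (a b d : τ)
    (k : ι → 𝓜) : Prop where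
  comm : ∀ s t {i j l m}, i ≠ j → l ≠ m → i ≠ l → i ≠ m → j ≠ l → j ≠ m →
    Commute (x s i j) (x t l m)
  comm_sol : ∀ s {i j l}, j ≠ l → i ≠ j → i ≠ l → Commute (k i) (x s j l)
  exchange : ∀ {i j}, i ≠ j →
    x a i j * k i * x b i j * k j = k j * x b j i * k i * x d i j
  ybe_a : ∀ {i j l}, i ≠ j → i ≠ l → j ≠ l →
    x a j l * x b i j * x b i l = x b i l * x b i j * x a j l
  ybe_d : ∀ {i j l}, i ≠ j → i ≠ l → j ≠ l →
    x d i j * x b i l * x b j l = x b j l * x b i l * x d i j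

section Grid

variable {τ ι 𝓜 : Type*} [Monoid 𝓜]

/-- The ordered product `∏→_{j∈N} x_{ij}`. -/
def rowProd (x : ι → ι → 𝓜) (i : ι) (N : List ι) : 𝓜 := (N.map fun j => x i j).prod

/-- The ordered product `∏→_{i∈M} x_{ij}`. -/
def colProd (x : ι → ι → 𝓜) (M : List ι) (j : ι) : 𝓜 := (M.map fun i => x i j).prod

/-- The ordered product `∏→_{i∈M} ∏→_{j∈N} x_{ij}`. -/
def gridProd (x : ι → ι → 𝓜) (M N : List ι) : 𝓜 := (M.map fun i => rowProd x i N).prod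

/-- The fused solution `∏→_{i∈M} (k_i ∏→_{j∈M, j>i} b_{ij})`. -/
def solProd (b : ι → ι → 𝓜) (k : ι → 𝓜) : List ι → 𝓜
  | [] => 1
  | i :: M => k i * rowProd b i M * solProd b k M

@[simp] lemma rowProd_nil (x : ι → ι → 𝓜) (i : ι) : rowProd x i [] = 1 := rfl

@[simp] lemma colProd_nil (x : ι → ι → 𝓜) (j : ι) : colProd x [] j = 1 := rfl

@[simp] lemma gridProd_nil (x : ι → ι → 𝓜) (N : List ι) : gridProd x [] N = 1 := rfl

@[simp] lemma gridProd_nil_right (x : ι → ι → 𝓜) (M : List ι) : gridProd x M [] = 1 := by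
  simp [gridProd]

lemma rowProd_cons (x : ι → ι → 𝓜) (i j : ι) (N : List ι) :
    rowProd x i (j :: N) = x i j * rowProd x i N := by
  simp [rowProd]

lemma rowProd_append (x : ι → ι → 𝓜) (i : ι) (N N' : List ι) :
    rowProd x i (N ++ N') = rowProd x i N * rowProd x i N' := by
  simp [rowProd]

lemma colProd_cons (x : ι → ι → 𝓜) (i j : ι) (M : List ι) :
    colProd x (i :: M) j = x i j * colProd x M j := by
  simp [colProd]

lemma gridProd_cons (x : ι → ι → 𝓜) (i : ι) (M N : List ι) :
    gridProd x (i :: M) N = rowProd x i N * gridProd x M N := by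
  simp [gridProd]

lemma commute_rowProd {x : ι → ι → 𝓜} {i : ι} {N : List ι} {y : 𝓜}
    (h : ∀ j ∈ N, Commute y (x i j)) : Commute y (rowProd x i N) :=
  Commute.list_prod_right _ _ (by simpa using h)

lemma commute_colProd {x : ι → ι → 𝓜} {j : ι} {M : List ι} {y : 𝓜}
    (h : ∀ i ∈ M, Commute y (x i j)) : Commute y (colProd x M j) :=
  Commute.list_prod_right _ _ (by simpa using h)

lemma commute_gridProd {x : ι → ι → 𝓜} {M N : List ι} {y : 𝓜}
    (h : ∀ i ∈ M, ∀ j ∈ N, Commute y (x i j)) : Commute y (gridProd x M N) :=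
  Commute.list_prod_right _ _ (by simpa using fun i hi => commute_rowProd (h i hi))

lemma commute_solProd {b : ι → ι → 𝓜} {k : ι → 𝓜} {M : List ι} {y : 𝓜} (hM : M.Nodup)
    (hk : ∀ i ∈ M, Commute y (k i))
    (hb : ∀ i ∈ M, ∀ j ∈ M, i ≠ j → Commute y (b i j)) : Commute y (solProd b k M) := by
  induction M with
  | nil => exact Commute.one_right _
  | cons i M ih =>
    refine ((hk i (by simp)).mul_right
      (commute_rowProd fun j hj => hb _ (by simp) _ ?_ ?_)).mul_right
        (ih ?_ (fun j hj => hk _ ?_) fun j hj l hl => hb _ ?_ _ ?_) <;> grind [List.Disjoint]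

variable {x : τ → ι → ι → 𝓜} {a b d : τ} {k : ι → 𝓜}

namespace ExchangeData

lemma gridProd_cons_right (H : ExchangeData x a b d k) (s : τ) {M N : List ι} {j : ι}
    (hM : M.Nodup) (hN : (j :: N).Nodup) (hMN : M.Disjoint (j :: N)) :
    gridProd (x s) M (j :: N) = colProd (x s) M j * gridProd (x s) M N := by
  induction M with
  | nil => simp
  | cons i M ih =>
    have hc : Commute (rowProd (x s) i N) (colProd (x s) M j) :=
      commute_colProd fun m hm => (commute_rowProd fun l hl =>
        by apply H.comm <;> grind [List.Disjoint]).symm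
    rw [gridProd_cons, ih hM.of_cons (by grind [List.Disjoint]), rowProd_cons, gridProd_cons,
      colProd_cons]
    simp only [mul_assoc]
    rw [hc.left_comm]

lemma gridProd_concat_right (H : ExchangeData x a b d k) (s : τ) {M N : List ι} {j : ι}
    (hM : M.Nodup) (hN : (j :: N).Nodup) (hMN : M.Disjoint (j :: N)) :
    gridProd (x s) M (N ++ [j]) = gridProd (x s) M N * colProd (x s) M j := by
  induction M with
  | nil => simp
  | cons i M ih =>
    have hc : Commute (x s i j) (gridProd (x s) M N) :=
      commute_gridProd fun m hm l hl =>
        by apply H.comm <;> grind [List.Disjoint]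
    rw [gridProd_cons, ih hM.of_cons (by grind [List.Disjoint]), rowProd_append, rowProd_cons,
      gridProd_cons, colProd_cons]
    simp only [mul_assoc, rowProd_nil, one_mul]
    rw [hc.left_comm]

lemma gridProd_swap (H : ExchangeData x a b d k) (s : τ) {M N : List ι}
    (hM : M.Nodup) (hN : N.Nodup) (hMN : M.Disjoint N) :
    gridProd (x s) M N = gridProd (fun i j => x s j i) N M := by
  induction N with
  | nil => simp
  | cons j N ih =>
    rw [H.gridProd_cons_right s hM hN hMN, ih hN.of_cons (by grind [List.Disjoint]), gridProd_cons]
    rfl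

lemma colProd_ybe (H : ExchangeData x a b d k) {M : List ι} {i n : ι} (hM : M.Nodup)
    (hi : i ∉ M) (hn : n ∉ M) (hin : i ≠ n) :
    colProd (x a) M n * rowProd (x b) i M * x b i n =
      x b i n * rowProd (x b) i M * colProd (x a) M n := by
  induction M with
  | nil => simp
  | cons j M ih =>
    have h₁ : Commute (x b i j) (colProd (x a) M n) := commute_colProd fun m hm =>
      by apply H.comm <;> grind [List.Disjoint]
    have h₂ : Commute (x a j n) (rowProd (x b) i M) := commute_rowProd fun m hm =>
      by apply H.comm <;> grind [List.Disjoint]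
    have h₃ := H.ybe_a (i := i) (j := j) (l := n) (by grind [List.Disjoint]) hin
      (by grind [List.Disjoint])
    have ih := ih hM.of_cons (by grind [List.Disjoint]) (by grind [List.Disjoint])
    rw [colProd_cons, rowProd_cons]
    calc x a j n * colProd (x a) M n * (x b i j * rowProd (x b) i M) * x b i n
        = x a j n * (x b i j * colProd (x a) M n) * rowProd (x b) i M * x b i n := by
          rw [h₁.eq]; simp only [mul_assoc]
      _ = x a j n * x b i j * (colProd (x a) M n * rowProd (x b) i M * x b i n) := by
          simp only [mul_assoc]
      _ = (x a j n * x b i j * x b i n) * rowProd (x b) i M * colProd (x a) M n := by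
          rw [ih]; simp only [mul_assoc]
      _ = x b i n * x b i j * (x a j n * rowProd (x b) i M) * colProd (x a) M n := by
          rw [h₃]; simp only [mul_assoc]
      _ = _ := by rw [h₂.eq]; simp only [mul_assoc]

lemma rowProd_ybe (H : ExchangeData x a b d k) {M : List ι} {i n : ι} (hM : M.Nodup)
    (hi : i ∉ M) (hn : n ∉ M) (hin : i ≠ n) :
    x d i n * rowProd (x b) i M * rowProd (x b) n M =
      rowProd (x b) n M * rowProd (x b) i M * x d i n := by
  induction M with
  | nil => simp
  | cons j M ih =>
    have h₁ : Commute (x b n j) (rowProd (x b) i M) := commute_rowProd fun m hm =>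
      by apply H.comm <;> grind [List.Disjoint]
    have h₂ : Commute (x b i j) (rowProd (x b) n M) := commute_rowProd fun m hm =>
      by apply H.comm <;> grind [List.Disjoint]
    have h₃ := H.ybe_d (i := i) (j := n) (l := j) hin
      (by grind [List.Disjoint]) (by grind [List.Disjoint])
    have ih := ih hM.of_cons (by grind [List.Disjoint]) (by grind [List.Disjoint])
    simp only [rowProd_cons]
    calc x d i n * (x b i j * rowProd (x b) i M) * (x b n j * rowProd (x b) n M)
        = x d i n * x b i j * (rowProd (x b) i M * x b n j) * rowProd (x b) n M := by
          simp only [mul_assoc]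
      _ = (x d i n * x b i j * x b n j) * rowProd (x b) i M * rowProd (x b) n M := by
          rw [← h₁.eq]; simp only [mul_assoc]
      _ = x b n j * x b i j * (x d i n * rowProd (x b) i M * rowProd (x b) n M) := by
          rw [h₃]; simp only [mul_assoc]
      _ = x b n j * (x b i j * rowProd (x b) n M) * rowProd (x b) i M * x d i n := by
          rw [ih]; simp only [mul_assoc]
      _ = _ := by rw [h₂.eq]; simp only [mul_assoc]

lemma gridProd_ybe_d (H : ExchangeData x a b d k) {M N : List ι} {n : ι} (hM : M.Nodup)
    (hN : (n :: N).Nodup) (hMN : M.Disjoint (n :: N)) :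
    colProd (x d) M n * gridProd (x b) M N * rowProd (x b) n N =
      rowProd (x b) n N * gridProd (x b) M N * colProd (x d) M n := by
  induction M with
  | nil => simp
  | cons i M ih =>
    have h₁ : Commute (colProd (x d) M n) (rowProd (x b) i N) := commute_rowProd fun m hm =>
      (commute_colProd fun l hl =>
        by apply H.comm <;> grind [List.Disjoint]).symm
    have h₂ : Commute (x d i n) (gridProd (x b) M N) := commute_gridProd fun m hm l hl =>
      by apply H.comm <;> grind [List.Disjoint]
    have h₃ := H.rowProd_ybe (M := N) (i := i) (n := n) hN.of_cons
      (by grind [List.Disjoint]) (by grind [List.Disjoint]) (by grind [List.Disjoint])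
    have ih := ih hM.of_cons (by grind [List.Disjoint])
    rw [colProd_cons, gridProd_cons]
    calc x d i n * colProd (x d) M n * (rowProd (x b) i N * gridProd (x b) M N) * rowProd (x b) n N
        = x d i n * (colProd (x d) M n * rowProd (x b) i N) * gridProd (x b) M N *
            rowProd (x b) n N := by simp only [mul_assoc]
      _ = x d i n * rowProd (x b) i N *
            (colProd (x d) M n * gridProd (x b) M N * rowProd (x b) n N) := by
          rw [h₁.eq]; simp only [mul_assoc]
      _ = (x d i n * rowProd (x b) i N * rowProd (x b) n N) * gridProd (x b) M N *
            colProd (x d) M n := by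
          rw [ih]; simp only [mul_assoc]
      _ = rowProd (x b) n N * rowProd (x b) i N * (x d i n * gridProd (x b) M N) *
            colProd (x d) M n := by
          rw [h₃]; simp only [mul_assoc]
      _ = _ := by rw [h₂.eq]; simp only [mul_assoc]

lemma gridProd_ybe_a (H : ExchangeData x a b d k) {M N : List ι} {n : ι} (hM : M.Nodup)
    (hN : (n :: N).Nodup) (hMN : M.Disjoint (n :: N)) :
    gridProd (x a) M N.reverse * rowProd (x b) n M * rowProd (x b) n N =
      rowProd (x b) n N * rowProd (x b) n M * gridProd (x a) M N.reverse := by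
  induction N with
  | nil => simp
  | cons j N ih =>
    have h₁ : Commute (x b n j) (gridProd (x a) M N.reverse) := commute_gridProd fun m hm l hl =>
      by apply H.comm <;> grind [List.Disjoint]
    have h₂ : Commute (colProd (x a) M j) (rowProd (x b) n N) := commute_rowProd fun m hm =>
      (commute_colProd fun l hl =>
        by apply H.comm <;> grind [List.Disjoint]).symm
    have h₃ := H.colProd_ybe (i := n) (n := j) hM
      (by grind [List.Disjoint]) (by grind [List.Disjoint]) (by grind [List.Disjoint])
    have ih := ih (by grind [List.Disjoint]) (by grind [List.Disjoint])
    rw [List.reverse_cons, H.gridProd_concat_right a hM (by grind [List.Disjoint])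
      (by grind [List.Disjoint]), rowProd_cons]
    calc gridProd (x a) M N.reverse * colProd (x a) M j * rowProd (x b) n M *
          (x b n j * rowProd (x b) n N)
        = gridProd (x a) M N.reverse * (colProd (x a) M j * rowProd (x b) n M * x b n j) *
            rowProd (x b) n N := by simp only [mul_assoc]
      _ = (gridProd (x a) M N.reverse * x b n j) * rowProd (x b) n M *
            (colProd (x a) M j * rowProd (x b) n N) := by
          rw [h₃]; simp only [mul_assoc]
      _ = x b n j * (gridProd (x a) M N.reverse * rowProd (x b) n M * rowProd (x b) n N) *
            colProd (x a) M j := by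
          rw [h₂.eq, ← h₁.eq]; simp only [mul_assoc]
      _ = _ := by rw [ih]; simp only [mul_assoc]

/-- Fusion in the first label set. -/
lemma exchange_col (H : ExchangeData x a b d k) {M : List ι} {n : ι} (hM : M.Nodup)
    (hn : n ∉ M) :
    colProd (x a) M n * solProd (x b) k M * colProd (x b) M n * k n =
      k n * rowProd (x b) n M * solProd (x b) k M * colProd (x d) M n := by
  induction M with
  | nil => simp [solProd]
  | cons i M ih =>
    have h₁ : Commute (k i) (colProd (x a) M n) := commute_colProd fun m hm =>
      by apply H.comm_sol <;> grind [List.Disjoint]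
    have h₂ : ∀ s, Commute (x s i n) (solProd (x b) k M) := fun s =>
      commute_solProd hM.of_cons
        (fun m hm => (by apply H.comm_sol <;> grind [List.Disjoint] : Commute _ _).symm)
        fun m hm l hl _ =>
          by apply H.comm <;> grind [List.Disjoint]
    have h₃ : Commute (k n) (rowProd (x b) i M) := commute_rowProd fun m hm =>
      by apply H.comm_sol <;> grind [List.Disjoint]
    have h₄ : Commute (k i) (rowProd (x b) n M) := commute_rowProd fun m hm =>
      by apply H.comm_sol <;> grind [List.Disjoint]
    have h₅ := H.colProd_ybe (M := M) (i := i) (n := n) hM.of_cons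
      (by grind [List.Disjoint]) (by grind [List.Disjoint]) (by grind [List.Disjoint])
    have h₆ := H.rowProd_ybe (M := M) (i := i) (n := n) hM.of_cons
      (by grind [List.Disjoint]) (by grind [List.Disjoint]) (by grind [List.Disjoint])
    have h₇ := H.exchange (i := i) (j := n) (by grind [List.Disjoint])
    have ih := ih hM.of_cons (by grind [List.Disjoint])
    simp only [colProd_cons, rowProd_cons, solProd]
    calc x a i n * colProd (x a) M n * (k i * rowProd (x b) i M * solProd (x b) k M) *
          (x b i n * colProd (x b) M n) * k n
        = x a i n * (colProd (x a) M n * k i) * rowProd (x b) i M *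
            (solProd (x b) k M * x b i n) * colProd (x b) M n * k n := by simp only [mul_assoc]
      _ = x a i n * k i * (colProd (x a) M n * rowProd (x b) i M * x b i n) *
            solProd (x b) k M * colProd (x b) M n * k n := by
          rw [← h₁.eq, ← (h₂ b).eq]; simp only [mul_assoc]
      _ = x a i n * k i * x b i n * rowProd (x b) i M *
            (colProd (x a) M n * solProd (x b) k M * colProd (x b) M n * k n) := by
          rw [h₅]; simp only [mul_assoc]
      _ = x a i n * k i * x b i n * (rowProd (x b) i M * k n) * rowProd (x b) n M *
            solProd (x b) k M * colProd (x d) M n := by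
          rw [ih]; simp only [mul_assoc]
      _ = (x a i n * k i * x b i n * k n) * rowProd (x b) i M * rowProd (x b) n M *
            solProd (x b) k M * colProd (x d) M n := by
          rw [← h₃.eq]; simp only [mul_assoc]
      _ = k n * x b n i * k i * (x d i n * rowProd (x b) i M * rowProd (x b) n M) *
            solProd (x b) k M * colProd (x d) M n := by
          rw [h₇]; simp only [mul_assoc]
      _ = k n * x b n i * (k i * rowProd (x b) n M) * rowProd (x b) i M *
            (x d i n * solProd (x b) k M) * colProd (x d) M n := by
          rw [h₆]; simp only [mul_assoc]
      _ = _ := by rw [h₄.eq, (h₂ d).eq]; simp only [mul_assoc]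

/-- Fusion of a quadratic exchange relation in both label sets. -/
theorem exchange_grid (H : ExchangeData x a b d k) {M N : List ι} (hM : M.Nodup) (hN : N.Nodup)
    (hMN : M.Disjoint N) :
    gridProd (x a) M N.reverse * solProd (x b) k M * gridProd (x b) M N * solProd (x b) k N =
      solProd (x b) k N * gridProd (x b) N M * solProd (x b) k M * gridProd (x d) M N.reverse := by
  induction N with
  | nil => simp [solProd]
  | cons n N ih =>
    have h₁ : ∀ s, ∀ N', N' ⊆ N → Commute (k n) (gridProd (x s) M N') := fun s N' hN' =>
      commute_gridProd fun m hm l hl => by apply H.comm_sol <;> grind [List.Disjoint]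
    have h₂ : Commute (rowProd (x b) n N) (solProd (x b) k M) := commute_solProd hM
      (fun m hm => (commute_rowProd fun l hl =>
        by apply H.comm_sol <;> grind [List.Disjoint]).symm)
      fun m hm m' hm' _ => (commute_rowProd fun l hl =>
        by apply H.comm <;> grind [List.Disjoint]).symm
    have h₃ : Commute (colProd (x d) M n) (solProd (x b) k N) := commute_solProd hN.of_cons
      (fun m hm => (commute_colProd fun l hl =>
        by apply H.comm_sol <;> grind [List.Disjoint]).symm)
      fun m hm m' hm' _ => (commute_colProd fun l hl =>
        by apply H.comm <;> grind [List.Disjoint]).symm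
    have h₄ : Commute (rowProd (x b) n M) (solProd (x b) k N) := commute_solProd hN.of_cons
      (fun m hm => (commute_rowProd fun l hl =>
        by apply H.comm_sol <;> grind [List.Disjoint]).symm)
      fun m hm m' hm' _ => (commute_rowProd fun l hl =>
        by apply H.comm <;> grind [List.Disjoint]).symm
    have h₅ := H.exchange_col (n := n) hM (by grind [List.Disjoint])
    have h₆ := H.gridProd_ybe_d hM hN hMN
    have h₇ := H.gridProd_ybe_a hM hN hMN
    have ih := ih hN.of_cons (by grind [List.Disjoint])
    simp only [List.reverse_cons, solProd]
    rw [H.gridProd_concat_right a hM (by grind [List.Disjoint]) (by grind [List.Disjoint]),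
      H.gridProd_concat_right d hM (by grind [List.Disjoint]) (by grind [List.Disjoint]),
      H.gridProd_cons_right b hM hN hMN, gridProd_cons]
    have h₁b := h₁ b N (by simp)
    have h₁a := h₁ a N.reverse (by simp)
    generalize gridProd (x a) M N.reverse = aMN at *
    generalize gridProd (x d) M N.reverse = dMN at *
    generalize gridProd (x b) M N = bMN at *
    generalize gridProd (x b) N M = bNM at *
    generalize solProd (x b) k M = kM at *
    generalize solProd (x b) k N = kN at *
    generalize colProd (x a) M n = aM at *
    generalize colProd (x b) M n = bM at *
    generalize colProd (x d) M n = dM at *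
    generalize rowProd (x b) n M = bnM at *
    generalize rowProd (x b) n N = bnN at *
    calc aMN * aM * kM * (bM * bMN) * (k n * bnN * kN)
        = aMN * aM * kM * bM * (bMN * k n) * bnN * kN := by simp only [mul_assoc]
      _ = aMN * (aM * kM * bM * k n) * bMN * bnN * kN := by
          rw [← h₁b.eq]; simp only [mul_assoc]
      _ = (aMN * k n) * bnM * kM * (dM * bMN * bnN) * kN := by
          rw [h₅]; simp only [mul_assoc]
      _ = k n * aMN * bnM * (kM * bnN) * bMN * (dM * kN) := by
          rw [h₆, ← h₁a.eq]; simp only [mul_assoc]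
      _ = k n * (aMN * bnM * bnN) * kM * bMN * kN * dM := by
          rw [← h₂.eq, h₃.eq]; simp only [mul_assoc]
      _ = k n * bnN * bnM * (aMN * kM * bMN * kN) * dM := by
          rw [h₇]; simp only [mul_assoc]
      _ = k n * bnN * (bnM * kN) * bNM * kM * dMN * dM := by
          rw [ih]; simp only [mul_assoc]
      _ = _ := by rw [h₄.eq]; simp only [mul_assoc]

end ExchangeData

end Grid

section Sites

variable {κ : Type*} [Fintype κ] [DecidableEq κ]

/-- The matrix unit `e_{ab}` at the site `i`. -/
noncomputable def unitAt [Zero α] [One α] (a b : Fin n) (i : ι) : Tens ι n α :=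
  emb1 (Matrix.single a b 1) i

/-- `X` acts as the identity at the site `k`, i.e. it commutes with all matrix units there. -/
def Avoids [Semiring α] (k : ι) (X : Tens ι n α) : Prop :=
  ∀ a b : Fin n, Commute (unitAt a b k) X

lemma unitAt_mul_apply [Semiring α] (a b : Fin n) (i : ι) (Y : Tens ι n α) (f g : ι → Fin n) :
    (unitAt a b i * Y : Tens ι n α) f g = if f i = a then Y (Function.update f i b) g else 0 := by
  rw [Matrix.mul_apply, Finset.sum_eq_single (Function.update f i b)]
  · simp +contextual [unitAt, emb1, Matrix.single_apply, eq_comm]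
  · intro h _ hh
    have : ¬ ((∀ k, k ≠ i → f k = h k) ∧ b = h i) := by
      rintro ⟨h₁, rfl⟩
      exact hh (by ext k; by_cases hk : k = i <;> simp_all)
    simp only [unitAt, emb1, Matrix.of_apply, Matrix.single_apply]
    grind
  · simp

lemma mul_unitAt_apply [Semiring α] (a b : Fin n) (i : ι) (Y : Tens ι n α) (f g : ι → Fin n) :
    (Y * unitAt a b i : Tens ι n α) f g = if g i = b then Y f (Function.update g i a) else 0 := by
  rw [Matrix.mul_apply, Finset.sum_eq_single (Function.update g i a)]
  · simp +contextual [unitAt, emb1, Matrix.single_apply, eq_comm]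
  · intro h _ hh
    have : ¬ ((∀ k, k ≠ i → h k = g k) ∧ a = h i) := by
      rintro ⟨h₁, rfl⟩
      exact hh (by ext k; by_cases hk : k = i <;> simp_all)
    simp only [unitAt, emb1, Matrix.of_apply, Matrix.single_apply]
    grind
  · simp

lemma avoids_iff [Semiring α] {k : ι} {X : Tens ι n α} :
    Avoids k X ↔ ∀ a b f g, (if f k = a then X (Function.update f k b) g else 0) =
      if g k = b then X f (Function.update g k a) else 0 := by
  simp only [Avoids, Commute, SemiconjBy, ← Matrix.ext_iff, unitAt_mul_apply, mul_unitAt_apply]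

lemma Avoids.list_prod [Semiring α] {k : ι} {l : List (Tens ι n α)} (h : ∀ X ∈ l, Avoids k X) :
    Avoids k l.prod := fun a b => Commute.list_prod_right _ _ fun X hX => h X hX a b

lemma avoids_emb1 [Semiring α] {i k : ι} (h : k ≠ i) (T : Matrix (Fin n) (Fin n) α) :
    Avoids k (emb1 T i) := by
  rw [avoids_iff]
  intro a b f g
  simp only [emb1, Matrix.of_apply, Function.update_apply, h.symm, if_false, ← ite_and]
  refine if_congr ?_ rfl rfl
  grind

lemma avoids_emb2 [Semiring α] {i j k : ι} (hi : k ≠ i) (hj : k ≠ j) (X : M2 n α) :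
    Avoids k (emb2 X i j) := by
  rw [avoids_iff]
  intro a b f g
  simp only [emb2, Matrix.of_apply, Function.update_apply, hi.symm, hj.symm, if_false, ← ite_and]
  refine if_congr ?_ rfl rfl
  grind

lemma emb2_eq_sum [Semiring α] {i j : ι} (h : i ≠ j) (X : M2 n α) :
    emb2 X i j = ∑ p, ∑ q, X p q • (unitAt p.1 q.1 i * unitAt p.2 q.2 j) := by
  ext f g
  simp only [Matrix.sum_apply, Matrix.smul_apply, smul_eq_mul, unitAt_mul_apply]
  rw [Finset.sum_eq_single (f i, f j), Finset.sum_eq_single (g i, g j)]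
  · simp only [emb2, unitAt, emb1, Matrix.of_apply, if_true, Matrix.single_apply,
      Function.update_of_ne h.symm, and_self, mul_ite, mul_one, mul_zero]
    refine if_congr ?_ rfl rfl
    simp only [Function.update_apply]
    grind
  · intro q _ hq
    simp only [unitAt, emb1, Matrix.of_apply, if_true, Matrix.single_apply,
      Function.update_of_ne h.symm]
    have : ¬ ((∀ k, k ≠ j → Function.update f i q.1 k = g k) ∧ q.2 = g j) := by
      rintro ⟨h₁, h₂⟩
      exact hq (Prod.ext (by simpa using h₁ i h) h₂)
    simp only [← ite_and]
    rw [if_neg (by grind), mul_zero]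
  · simp
  · intro p _ hp
    refine Finset.sum_eq_zero fun q _ => ?_
    simp only [unitAt, emb1, Matrix.of_apply, Matrix.single_apply,
      Function.update_of_ne h.symm]
    have : ¬ (f i = p.1 ∧ f j = p.2) := fun h' => hp (Prod.ext h'.1.symm h'.2.symm)
    simp only [← ite_and]
    rw [if_neg (by grind), mul_zero]
  · simp

lemma map_emb2 {i j : ι} (X : M2 n ℂ) :
    (emb2 X i j).map (algebraMap ℂ R) = emb2 (X.map (algebraMap ℂ R)) i j := by
  ext f g
  simp only [emb2, Matrix.map_apply, Matrix.of_apply, apply_ite (algebraMap ℂ R), map_zero]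

lemma commute_emb2_map {i j : ι} (h : i ≠ j) (X : M2 n ℂ) {Y : Tens ι n R} (hi : Avoids i Y)
    (hj : Avoids j Y) : Commute ((emb2 X i j).map (algebraMap ℂ R)) Y := by
  rw [map_emb2, emb2_eq_sum h]
  refine Commute.sum_left _ _ _ fun p _ => Commute.sum_left _ _ _ fun q _ => ?_
  rw [Matrix.map_apply, algebraMap_smul]
  exact ((hi _ _).mul_left (hj _ _)).smul_left _

/-- Relabelling of the sites along `e`, acting as the identity off the range of `e`. -/
noncomputable def relabel [Zero α] (e : κ → ι) (X : Tens κ n α) : Tens ι n α :=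
  Matrix.of fun f g => if ∀ k, (∀ a, e a ≠ k) → f k = g k then X (f ∘ e) (g ∘ e) else 0

lemma relabel_mul [Semiring α] {e : κ → ι} (he : Function.Injective e) (X Y : Tens κ n α) :
    relabel e (X * Y) = relabel e X * relabel e Y := by
  ext f g
  simp only [relabel, Matrix.of_apply, Matrix.mul_apply]
  split_ifs with hfg
  · refine Finset.sum_of_injOn (fun h => Function.extend e h f) ?_ (by simp) ?_ ?_
    · intro h _ h' _ hh
      funext a
      simpa [he.extend_apply] using congrFun hh (e a)
    · intro h _ hh
      by_cases hc : ∀ k, (∀ a, e a ≠ k) → f k = h k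
      · refine absurd ⟨h ∘ e, by simp, ?_⟩ hh
        funext k
        change Function.extend e (h ∘ e) f k = h k
        by_cases hk : ∃ a, e a = k
        · obtain ⟨a, rfl⟩ := hk
          simp [he.extend_apply]
        · rw [Function.extend_apply' _ _ _ hk]
          exact hc k (by simpa using hk)
      · rw [if_neg hc, zero_mul]
    · intro h _
      have hk : ∀ k, (∀ a, e a ≠ k) → Function.extend e h f k = f k := fun k hk =>
        Function.extend_apply' _ _ _ (by simpa using hk)
      have h₁ : ∀ k, (∀ a, e a ≠ k) → f k = Function.extend e h f k := fun k h' => (hk k h').symm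
      have h₂ : ∀ k, (∀ a, e a ≠ k) → Function.extend e h f k = g k := fun k h' =>
        (hk k h').trans (hfg k h')
      rw [if_pos h₁, if_pos h₂]
      simp only [Function.extend_comp he]
  · refine (Finset.sum_eq_zero fun h _ => ?_).symm
    by_cases h₁ : ∀ k, (∀ a, e a ≠ k) → f k = h k
    · have h₂ : ¬ ∀ k, (∀ a, e a ≠ k) → h k = g k := fun h₂ =>
        hfg fun k hk => (h₁ k hk).trans (h₂ k hk)
      rw [if_neg h₂, mul_zero]
    · rw [if_neg h₁, zero_mul]

lemma relabel_emb1 [Zero α] {e : κ → ι} (he : Function.Injective e)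
    (T : Matrix (Fin n) (Fin n) α) (a : κ) : relabel e (emb1 T a) = emb1 T (e a) := by
  ext f g
  simp only [relabel, emb1, Matrix.of_apply, Function.comp_apply, ← ite_and]
  refine if_congr ⟨fun ⟨h₁, h₂⟩ k hk => ?_, fun h => ⟨fun k hk => h k (hk a).symm, fun b hb =>
    h _ (he.ne hb)⟩⟩ rfl rfl
  by_cases hk' : ∃ b, e b = k
  · obtain ⟨b, rfl⟩ := hk'
    exact h₂ b fun hb => hk (hb ▸ rfl)
  · exact h₁ k (by simpa using hk')

lemma relabel_emb2 [MulZeroOneClass α] {e : κ → ι} (he : Function.Injective e) (X : M2 n α)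
    (a b : κ) : relabel e (emb2 X a b) = emb2 X (e a) (e b) := by
  ext f g
  simp only [relabel, emb2, Matrix.of_apply, Function.comp_apply, ← ite_and]
  refine if_congr ⟨fun ⟨h₁, h₂⟩ k hk hk' => ?_, fun h => ⟨fun k hk => h k (hk a).symm (hk b).symm,
    fun c ha hb => h _ (he.ne ha) (he.ne hb)⟩⟩ rfl rfl
  by_cases hc : ∃ c, e c = k
  · obtain ⟨c, rfl⟩ := hc
    exact h₂ c (fun hb => hk (hb ▸ rfl)) fun hb => hk' (hb ▸ rfl)
  · exact h₁ k (by simpa using hc)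

lemma emb2_one [Semiring α] (i j : ι) : emb2 (1 : M2 n α) i j = 1 := by
  ext f g
  simp only [emb2, Matrix.of_apply, Matrix.one_apply, ← ite_and, Prod.mk.injEq]
  refine if_congr ⟨fun h => ?_, by grind⟩ rfl rfl
  funext k
  by_cases hi : k = i
  · rw [hi, h.2.1]
  · by_cases hj : k = j
    · rw [hj, h.2.2]
    · exact h.1 k hi hj

lemma emb2_mul [Semiring α] {i j : ι} (h : i ≠ j) (X Y : M2 n α) :
    emb2 (X * Y) i j = emb2 X i j * emb2 Y i j := by
  have he : Function.Injective ![i, j] := by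
    intro a b
    fin_cases a <;> fin_cases b <;> simp [h, h.symm]
  have h₂ : ∀ Z : M2 n α, emb2 Z (0 : Fin 2) 1 =
      Z.submatrix (finTwoArrowEquiv (Fin n)) (finTwoArrowEquiv (Fin n)) := by
    intro Z
    ext f g
    simp only [emb2, Matrix.of_apply, Matrix.submatrix_apply, finTwoArrowEquiv_apply]
    exact if_pos (by simp [Fin.forall_fin_two])
  have h₃ : ∀ Z : M2 n α, emb2 Z i j = relabel ![i, j] (emb2 Z 0 1) := fun Z =>
    (relabel_emb2 he Z 0 1).symm
  rw [h₃, h₃ X, h₃ Y, ← relabel_mul he, h₂, h₂, h₂, Matrix.submatrix_mul_equiv]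

lemma inv_emb2 {i j : ι} (h : i ≠ j) {X : M2 n ℂ} (hX : IsUnit X) :
    (emb2 X i j)⁻¹ = emb2 X⁻¹ i j := by
  refine Matrix.inv_eq_right_inv ?_
  rw [← emb2_mul h, Matrix.mul_nonsing_inv _ ((Matrix.isUnit_iff_isUnit_det _).1 hX), emb2_one]

lemma emb2_perm2 [MulZeroOneClass α] (X : M2 n α) (i j : ι) :
    emb2 (perm2 X) i j = emb2 X j i := by
  ext f g
  simp only [emb2, perm2, Matrix.of_apply]
  exact if_congr (by grind) rfl rfl

end Sites

section PartialTranspose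

lemma ptrans_apply {ι : Type*} [DecidableEq ι] (S : Finset ι) (X : Tens ι n α) (f g : ι → Fin n) :
    ptrans S X f g =
      X (fun k => if k ∈ S then g k else f k) (fun k => if k ∈ S then f k else g k) := rfl

@[simp] lemma ptrans_empty {ι : Type*} [DecidableEq ι] (X : Tens ι n α) : ptrans ∅ X = X := by
  ext f g
  simp [ptrans_apply]

lemma ptrans_union {ι : Type*} [DecidableEq ι] {S T : Finset ι} (h : Disjoint S T)
    (X : Tens ι n α) :
    ptrans (S ∪ T) X = ptrans S (ptrans T X) := by
  ext f g
  simp only [ptrans_apply]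
  congr 1 <;> funext k <;> have := @Finset.disjoint_left.1 h k <;> grind

lemma ptrans_eq_transpose_compl (S : Finset ι) (X : Tens ι n α) :
    ptrans S X = (ptrans Sᶜ X)ᵀ := by
  ext f g
  simp only [ptrans_apply, Matrix.transpose_apply]
  congr 1 <;> funext k <;> grind [Finset.mem_compl]

lemma ptrans_singleton [Semiring α] (i : ι) (X : Tens ι n α) :
    ptrans {i} X = ∑ a, ∑ b, unitAt a b i * X * unitAt a b i := by
  ext f g
  simp only [Matrix.sum_apply, mul_unitAt_apply, unitAt_mul_apply]
  rw [Finset.sum_eq_single (f i) (by simp +contextual [eq_comm]) (by simp),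
    Finset.sum_eq_single (g i) (by simp +contextual [eq_comm]) (by simp)]
  simp only [if_true, ptrans_apply]
  congr 1 <;> funext k <;> simp only [Finset.mem_singleton, Function.update_apply] <;>
    split_ifs with h <;> simp [h]

lemma Avoids.ptrans [Semiring α] {i : ι} {S : Finset ι} (hi : i ∉ S) {X : Tens ι n α}
    (hX : Avoids i X) : Avoids i (ptrans S X) := by
  rw [avoids_iff] at hX ⊢
  intro a b f g
  have h := hX a b (fun k => if k ∈ S then g k else f k) (fun k => if k ∈ S then f k else g k)
  simp only [hi, if_false] at h
  simp only [ptrans_apply]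
  convert h using 3 <;> funext k <;> simp only [Function.update_apply] <;> grind

lemma Avoids.ptrans_singleton_mul [Semiring α] {i : ι} {X Y : Tens ι n α} (hX : Avoids i X) :
    QT.ptrans {i} (X * Y) = X * QT.ptrans {i} Y := by
  simp only [QT.ptrans_singleton, Finset.mul_sum]
  refine Finset.sum_congr rfl fun a _ => Finset.sum_congr rfl fun b _ => ?_
  simp only [← mul_assoc, (hX a b).eq]

lemma Avoids.ptrans_singleton_mul' [Semiring α] {i : ι} {X Y : Tens ι n α} (hY : Avoids i Y) :
    QT.ptrans {i} (X * Y) = QT.ptrans {i} X * Y := by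
  simp only [QT.ptrans_singleton, Finset.sum_mul]
  refine Finset.sum_congr rfl fun a _ => Finset.sum_congr rfl fun b _ => ?_
  simp only [mul_assoc, (hY a b).eq]

lemma ptrans_one [Semiring α] (S : Finset ι) : ptrans S (1 : Tens ι n α) = 1 := by
  ext f g
  simp only [ptrans_apply, Matrix.one_apply, funext_iff]
  exact if_congr (forall_congr' fun k => by grind) rfl rfl

lemma Avoids.ptrans_singleton_eq [Semiring α] {i : ι} {X : Tens ι n α} (hX : Avoids i X) :
    QT.ptrans {i} X = X := by
  simpa [ptrans_one] using hX.ptrans_singleton_mul (Y := 1)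

/-- Partial transposition preserves a product whose factors share no transposed site. -/
lemma ptrans_mul [Semiring α] {S : Finset ι} {X Y : Tens ι n α}
    (h : ∀ k ∈ S, Avoids k X ∨ Avoids k Y) :
    ptrans S (X * Y) = ptrans S X * ptrans S Y := by
  induction S using Finset.induction_on with
  | empty => simp
  | insert i S hi ih =>
    have hd : Disjoint {i} S := by simpa
    have hS : insert i S = {i} ∪ S := rfl
    rw [hS, ptrans_union hd, ptrans_union hd, ptrans_union hd,
      ih fun k hk => h k (Finset.mem_insert_of_mem hk)]
    rcases h i (Finset.mem_insert_self i S) with hX | hY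
    · rw [(hX.ptrans hi).ptrans_singleton_mul, (hX.ptrans hi).ptrans_singleton_eq]
    · rw [(hY.ptrans hi).ptrans_singleton_mul', (hY.ptrans hi).ptrans_singleton_eq]

/-- Partial transposition reverses a product all of whose shared sites are transposed. -/
lemma ptrans_mul_rev [CommSemiring α] {S : Finset ι} {X Y : Tens ι n α}
    (h : ∀ k ∉ S, Avoids k X ∨ Avoids k Y) :
    ptrans S (X * Y) = ptrans S Y * ptrans S X := by
  rw [ptrans_eq_transpose_compl, ptrans_mul fun k hk => h k (Finset.mem_compl.1 hk),
    Matrix.transpose_mul, ← ptrans_eq_transpose_compl, ← ptrans_eq_transpose_compl]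

lemma ptrans_list_prod [Semiring α] {S : Finset ι} {l : List (Tens ι n α)}
    (h : l.Pairwise fun X Y => ∀ k ∈ S, Avoids k X ∨ Avoids k Y) :
    ptrans S l.prod = (l.map (ptrans S)).prod := by
  induction l with
  | nil => simp [ptrans_one]
  | cons X l ih =>
    rw [List.pairwise_cons] at h
    rw [List.prod_cons, ptrans_mul, ih h.2, List.map_cons, List.prod_cons]
    exact fun k hk => or_iff_not_imp_left.2 fun hX =>
      Avoids.list_prod fun Y hY => (h.1 Y hY k hk).resolve_left hX

lemma ptrans_list_prod_rev [CommSemiring α] {S : Finset ι} {l : List (Tens ι n α)}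
    (h : l.Pairwise fun X Y => ∀ k ∉ S, Avoids k X ∨ Avoids k Y) :
    ptrans S l.prod = (l.map (ptrans S)).reverse.prod := by
  rw [ptrans_eq_transpose_compl,
    ptrans_list_prod (h.imp fun hXY k hk => hXY k (Finset.mem_compl.1 hk)),
    Matrix.transpose_list_prod, List.map_map, ← List.map_reverse]
  simp only [Function.comp_def, ← ptrans_eq_transpose_compl, List.map_reverse]

lemma ptrans_emb2_left [MulZeroOneClass α] {S : Finset ι} {i j : ι} (hi : i ∈ S) (hj : j ∉ S)
    (X : M2 n α) : ptrans S (emb2 X i j) = emb2 (t1 X) i j := by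
  ext f g
  simp only [ptrans_apply, emb2, t1, Matrix.of_apply, hi, hj, if_true, if_false]
  exact if_congr (forall_congr' fun k => by grind) rfl rfl

lemma ptrans_emb2_right [MulZeroOneClass α] {S : Finset ι} {i j : ι} (hi : i ∉ S) (hj : j ∈ S)
    (X : M2 n α) : ptrans S (emb2 X i j) = emb2 (t2 X) i j := by
  ext f g
  simp only [ptrans_apply, emb2, t2, Matrix.of_apply, hi, hj, if_true, if_false]
  exact if_congr (forall_congr' fun k => by grind) rfl rfl

lemma ptrans_emb2_both [MulZeroOneClass α] {S : Finset ι} {i j : ι} (hi : i ∈ S) (hj : j ∈ S)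
    (X : M2 n α) : ptrans S (emb2 X i j) = emb2 Xᵀ i j := by
  ext f g
  simp only [ptrans_apply, emb2, Matrix.transpose_apply, Matrix.of_apply, hi, hj, if_true]
  exact if_congr (forall_congr' fun k => by grind) rfl rfl

end PartialTranspose

section Fuse

lemma avoids_row [Semiring α] {k i : ι} {N : List ι} (X : M2 n α) (hi : k ≠ i) (hN : k ∉ N) :
    Avoids k (N.map fun j => emb2 X i j).prod :=
  Avoids.list_prod (by
    simp only [List.mem_map, forall_exists_index, and_imp, forall_apply_eq_imp_iff₂]
    exact fun j hj => avoids_emb2 hi (by grind) X)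

lemma fuse_inv {X : M2 n ℂ} (hX : IsUnit X) {M N : List ι} (h : M.Disjoint N) :
    (fuse X M N)⁻¹ = fuse X⁻¹ M.reverse N.reverse := by
  have hrow : ∀ i ∈ M, ((N.map fun j => emb2 X i j).prod)⁻¹ =
      (N.reverse.map fun j => emb2 X⁻¹ i j).prod := fun i hi => by
    rw [Matrix.list_prod_inv_reverse, ← List.map_reverse, List.map_map]
    exact congrArg List.prod <| List.map_congr_left fun j hj =>
      inv_emb2 (by grind [List.Disjoint]) hX
  rw [fuse, Matrix.list_prod_inv_reverse, ← List.map_reverse, List.map_map]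
  exact congrArg List.prod <| List.map_congr_left fun i hi => hrow i (by simpa using hi)

lemma ptrans_fuse_left {S : Finset ι} {M N : List ι} (hM : M.Nodup) (hN : N.Nodup)
    (hMS : ∀ i ∈ M, i ∈ S) (hNS : ∀ j ∈ N, j ∉ S) (X : M2 n ℂ) :
    ptrans S (fuse X M N) = fuse (t1 X) M N.reverse := by
  rw [fuse, ptrans_list_prod, List.map_map]
  · refine congrArg List.prod <| List.map_congr_left fun i hi => ?_
    rw [Function.comp_apply, ptrans_list_prod_rev, ← List.map_reverse, ← List.map_reverse,
      List.map_map]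
    · exact congrArg List.prod <| List.map_congr_left fun j hj =>
        ptrans_emb2_left (hMS i hi) (hNS j (by simpa using hj)) X
    · rw [List.pairwise_map]
      refine hN.imp fun {j l} hjl k hk => ?_
      by_cases hkj : k = j
      · exact .inr (avoids_emb2 (by grind) (by grind) X)
      · exact .inl (avoids_emb2 (by grind) (by grind) X)
  · rw [List.pairwise_map]
    refine hM.imp fun {i l} hil k hk => ?_
    by_cases hki : k = i
    · exact .inr (avoids_row X (by grind) (by grind))
    · exact .inl (avoids_row X (by grind) (by grind))

lemma ptrans_fuse_right {S : Finset ι} {M N : List ι} (hM : M.Nodup) (hN : N.Nodup)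
    (hMS : ∀ i ∈ M, i ∉ S) (hNS : ∀ j ∈ N, j ∈ S) (X : M2 n ℂ) :
    ptrans S (fuse X M N) = fuse (t2 X) M.reverse N := by
  rw [fuse, ptrans_list_prod_rev, List.map_map, ← List.map_reverse]
  · refine congrArg List.prod <| List.map_congr_left fun i hi => ?_
    rw [Function.comp_apply, ptrans_list_prod, List.map_map]
    · exact congrArg List.prod <| List.map_congr_left fun j hj =>
        ptrans_emb2_right (hMS i (by simpa using hi)) (hNS j hj) X
    · rw [List.pairwise_map]
      refine hN.imp fun {j l} hjl k hk => ?_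
      have hki : k ≠ i := fun h => hMS i (by simpa using hi) (h ▸ hk)
      by_cases hkj : k = j
      · exact .inr (avoids_emb2 hki (by grind) X)
      · exact .inl (avoids_emb2 hki (by grind) X)
  · rw [List.pairwise_map]
    refine hM.imp fun {i l} hil k hk => ?_
    by_cases hki : k = i
    · exact .inr (avoids_row X (by grind) (by grind))
    · exact .inl (avoids_row X (by grind) (by grind))

lemma ptrans_fuse_both {S : Finset ι} {M N : List ι}
    (hMS : ∀ i ∈ M, i ∈ S) (hNS : ∀ j ∈ N, j ∈ S) (X : M2 n ℂ) :
    ptrans S (fuse X M N) = fuse Xᵀ M.reverse N.reverse := by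
  have hrow : ∀ i ∈ M, ptrans S (N.map fun j => emb2 X i j).prod =
      (N.reverse.map fun j => emb2 Xᵀ i j).prod := fun i hi => by
    rw [ptrans_list_prod_rev, ← List.map_reverse, ← List.map_reverse, List.map_map]
    · exact congrArg List.prod <| List.map_congr_left fun j hj =>
        ptrans_emb2_both (hMS i hi) (hNS j (by simpa using hj)) X
    · rw [List.pairwise_map]
      exact List.pairwise_of_forall_mem_list fun j hj l hl k hk =>
        .inl (avoids_emb2 (by grind) (by grind) X)
  rw [fuse, ptrans_list_prod_rev, List.map_map, ← List.map_reverse]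
  · exact congrArg List.prod <| List.map_congr_left fun i hi => hrow i (by simpa using hi)
  · rw [List.pairwise_map]
    exact List.pairwise_of_forall_mem_list fun i hi l hl k hk =>
      .inl (avoids_row X (by grind) (by grind))

end Fuse

section DualFuse

lemma fuse_dual_A {A : M2 n ℂ} (hA : IsUnit A) {M N : List ι} (h : M.Disjoint N) :
    ptrans N.toFinset (ptrans M.toFinset ((fuse A M N.reverse)⁻¹)) =
      fuse (A⁻¹)ᵀ M N.reverse := by
  rw [fuse_inv hA (by simpa [List.Disjoint] using h),
    ← ptrans_union (List.disjoint_toFinset_iff_disjoint.2 h.symm),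
    ptrans_fuse_both] <;> simp +contextual

lemma fuse_dual_B {B : M2 n ℂ} (hB : IsUnit (t1 B)) {M N : List ι} (hM : M.Nodup)
    (hN : N.Nodup) (h : M.Disjoint N) :
    ptrans N.toFinset ((ptrans M.toFinset (fuse B M N))⁻¹) = fuse (t2 (t1 B)⁻¹) M N := by
  rw [ptrans_fuse_left hM hN (by simp) (by simpa [List.Disjoint] using h.symm),
    fuse_inv hB (by simpa [List.Disjoint] using h), List.reverse_reverse,
    ptrans_fuse_right (by simpa using hM) hN (by simpa [List.Disjoint] using h) (by simp),
    List.reverse_reverse]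

lemma fuse_dual_C {C : M2 n ℂ} (hC : IsUnit (t2 C)) {M N : List ι} (hM : M.Nodup)
    (hN : N.Nodup) (h : M.Disjoint N) :
    ptrans M.toFinset ((ptrans N.toFinset (fuse C M N))⁻¹) = fuse (t1 (t2 C)⁻¹) M N := by
  rw [ptrans_fuse_right hM hN (by simpa [List.Disjoint] using h) (by simp),
    fuse_inv hC (by simpa [List.Disjoint] using h), List.reverse_reverse,
    ptrans_fuse_left hM (by simpa using hN) (by simp) (by simpa [List.Disjoint] using h.symm),
    List.reverse_reverse]

lemma fuse_dual_D {D : M2 n ℂ} (hD : IsUnit D) {M N : List ι} (h : M.Disjoint N) :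
    (ptrans N.toFinset (ptrans M.toFinset (fuse D M N.reverse)))⁻¹ =
      fuse (Dᵀ)⁻¹ M N.reverse := by
  rw [← ptrans_union (List.disjoint_toFinset_iff_disjoint.2 h.symm),
    ptrans_fuse_both (by simp +contextual) (by simp +contextual),
    fuse_inv ((Matrix.isUnit_transpose D).2 hD) (by simpa [List.Disjoint] using h)]
  simp

lemma t1_inv_t2_perm2 (X : M2 n ℂ) : t1 ((t2 X)⁻¹) = perm2 (t2 ((t1 (perm2 X))⁻¹)) := by
  have h : t1 (perm2 X) =
      (t2 X).submatrix (Equiv.prodComm (Fin n) (Fin n)) (Equiv.prodComm (Fin n) (Fin n)) := rfl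
  rw [h, Matrix.inv_submatrix_equiv]
  rfl

end DualFuse

section YangBaxter

variable {i j l a b : ι} {X Y : M2 n ℂ}

lemma ybe_relabel (h : emb2 (ι := Fin 3) X 0 1 * emb2 Y 0 2 * emb2 Y 1 2 =
      emb2 Y 1 2 * emb2 Y 0 2 * emb2 X 0 1) (hij : i ≠ j) (hil : i ≠ l) (hjl : j ≠ l) :
    emb2 X i j * emb2 Y i l * emb2 Y j l = emb2 Y j l * emb2 Y i l * emb2 X i j := by
  have he : Function.Injective ![i, j, l] := by
    intro a b
    fin_cases a <;> fin_cases b <;> simp [hij, hil, hjl, hij.symm, hil.symm, hjl.symm]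
  simpa [relabel_mul he, relabel_emb2 he] using congrArg (relabel ![i, j, l]) h

lemma ybe_ptrans_right (h : emb2 X i j * emb2 Y a l * emb2 Y b l =
      emb2 Y b l * emb2 Y a l * emb2 X i j) (hi : i ≠ l) (hj : j ≠ l) (ha : a ≠ l) (hb : b ≠ l)
    (hab : a ≠ b) :
    emb2 X i j * emb2 (t2 Y) b l * emb2 (t2 Y) a l =
      emb2 (t2 Y) a l * emb2 (t2 Y) b l * emb2 X i j := by
  have hX : Avoids l (emb2 X i j) := avoids_emb2 hi.symm hj.symm X
  have hY : ∀ c d, c ≠ l → d ≠ l → c ≠ d → ptrans {l} (emb2 Y c l * emb2 Y d l) =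
      emb2 (t2 Y) d l * emb2 (t2 Y) c l := fun c d hc hd hcd => by
    rw [ptrans_mul_rev, ptrans_emb2_right (by simpa) (by simp),
      ptrans_emb2_right (by simpa) (by simp)]
    intro k hk
    have hk : k ≠ l := by simpa using hk
    by_cases hkc : k = c
    · exact .inr (avoids_emb2 (by grind) hk Y)
    · exact .inl (avoids_emb2 hkc hk Y)
  rw [mul_assoc] at h
  have h' := congrArg (ptrans {l}) h
  rw [hX.ptrans_singleton_mul, hX.ptrans_singleton_mul', hY a b ha hb hab,
    hY b a hb ha hab.symm] at h'
  rw [mul_assoc, h']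

lemma ybe_ptrans_left (h : emb2 X i j * emb2 Y a l * emb2 Y b l =
      emb2 Y b l * emb2 Y a l * emb2 X i j) (hi : i ≠ l) (hj : j ≠ l)
    (ha : a = i ∨ a = j) (hb : b = i ∨ b = j) (hab : a ≠ b) :
    emb2 Xᵀ i j * emb2 (t1 Y) b l * emb2 (t1 Y) a l =
      emb2 (t1 Y) a l * emb2 (t1 Y) b l * emb2 Xᵀ i j := by
  have hX : ∀ k ∉ ({i, j} : Finset ι), Avoids k (emb2 X i j) := fun k hk =>
    avoids_emb2 (by grind) (by grind) X
  have hXt : ptrans {i, j} (emb2 X i j) = emb2 Xᵀ i j := ptrans_emb2_both (by simp) (by simp) X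
  have hY : ∀ c d, (c = i ∨ c = j) → (d = i ∨ d = j) → c ≠ d →
      ptrans {i, j} (emb2 Y c l * emb2 Y d l) = emb2 (t1 Y) c l * emb2 (t1 Y) d l :=
    fun c d hc hd hcd => by
      rw [ptrans_mul, ptrans_emb2_left (by grind) (by grind),
        ptrans_emb2_left (by grind) (by grind)]
      intro k hk
      by_cases hkc : k = c
      · exact .inr (avoids_emb2 (by grind) (by grind) Y)
      · exact .inl (avoids_emb2 hkc (by grind) Y)
  rw [mul_assoc] at h
  have h' := congrArg (ptrans {i, j}) h
  rw [ptrans_mul_rev fun k hk => .inl (hX k hk), ptrans_mul_rev fun k hk => .inr (hX k hk),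
    hY a b ha hb hab, hY b a hb ha hab.symm, hXt] at h'
  rw [mul_assoc, ← h', mul_assoc]

lemma ybe_inv (h : emb2 X i j * emb2 Y a l * emb2 Y b l =
      emb2 Y b l * emb2 Y a l * emb2 X i j) (hX : IsUnit X) (hY : IsUnit Y) (hij : i ≠ j)
    (ha : a ≠ l) (hb : b ≠ l) :
    emb2 X⁻¹ i j * emb2 Y⁻¹ a l * emb2 Y⁻¹ b l =
      emb2 Y⁻¹ b l * emb2 Y⁻¹ a l * emb2 X⁻¹ i j := by
  have h' := congrArg (·⁻¹) h
  simp only [Matrix.mul_inv_rev, inv_emb2 hij hX, inv_emb2 ha hY, inv_emb2 hb hY] at h'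
  simpa only [mul_assoc] using h'.symm

end YangBaxter

section DualExchange

lemma map_fuse (X : M2 n ℂ) (M N : List ι) :
    (fuse X M N).map (algebraMap ℂ R) =
      gridProd (fun i j => (emb2 X i j).map (algebraMap ℂ R)) M N := by
  simp only [fuse, gridProd, rowProd, ← RingHom.mapMatrix_apply, map_list_prod, List.map_map,
    Function.comp_def]

lemma fuseT_eq_solProd (B : M2 n ℂ) (K : Matrix (Fin n) (Fin n) R) (M : List ι) :
    fuseT B K M = solProd (fun i j => (emb2 B i j).map (algebraMap ℂ R)) (emb1 K) M := by
  induction M with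
  | nil => rfl
  | cons i M ih => rw [fuseT, ih]; rfl

lemma exchangeData_dual {A B C D : M2 n ℂ}
    (hYBAC : emb2 (ι := Fin 3) A 0 1 * emb2 C 0 2 * emb2 C 1 2 =
      emb2 C 1 2 * emb2 C 0 2 * emb2 A 0 1)
    (hYBDB : emb2 (ι := Fin 3) D 0 1 * emb2 B 0 2 * emb2 B 1 2 =
      emb2 B 1 2 * emb2 B 0 2 * emb2 D 0 1)
    (hBC : B = perm2 C) (hA : IsUnit A) (hD : IsUnit D) (hB : IsUnit (t1 B))
    (hC : IsUnit (t2 C)) {K : Matrix (Fin n) (Fin n) R}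
    (hK : (emb2 (ι := Fin 2) (A⁻¹)ᵀ 0 1).map (algebraMap ℂ R) * emb1 K 0 *
          (emb2 (t2 ((t1 B)⁻¹)) 0 1).map (algebraMap ℂ R) * emb1 K 1 =
        emb1 K 1 * (emb2 (t1 ((t2 C)⁻¹)) 0 1).map (algebraMap ℂ R) * emb1 K 0 *
          (emb2 (Dᵀ)⁻¹ 0 1).map (algebraMap ℂ R)) :
    ExchangeData (fun (X : M2 n ℂ) (i j : ι) => (emb2 X i j).map (algebraMap ℂ R))
      (A⁻¹)ᵀ (t2 ((t1 B)⁻¹)) (Dᵀ)⁻¹ (emb1 K) where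
  comm X Y i j l m hij hlm hil him hjl hjm := by
    refine commute_emb2_map hij X ?_ ?_ <;> rw [map_emb2]
    exacts [avoids_emb2 hil him _, avoids_emb2 hjl hjm _]
  comm_sol X i j l hjl hij hil :=
    (commute_emb2_map hjl X (avoids_emb1 hij.symm K) (avoids_emb1 hil.symm K)).symm
  exchange {i j} hij := by
    have he : Function.Injective ![i, j] := by
      intro a b
      fin_cases a <;> fin_cases b <;> simp [hij, hij.symm]
    rw [t1_inv_t2_perm2, ← hBC] at hK
    simpa [map_emb2, relabel_mul he, relabel_emb1 he, relabel_emb2 he, emb2_perm2,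
      ← map_emb2 (perm2 _)] using congrArg (relabel ![i, j]) hK
  ybe_a {i j l} hij hil hjl := by
    have h := ybe_relabel hYBAC hjl hij.symm hil.symm
    have h := ybe_ptrans_right h hij.symm hil.symm hij.symm hil.symm hjl
    have h := ybe_inv h hA hC hjl hil.symm hij.symm
    have h := ybe_ptrans_left h hij.symm hil.symm (.inr rfl) (.inl rfl) hjl.symm
    rw [t1_inv_t2_perm2, ← hBC] at h
    simpa only [emb2_perm2, Matrix.map_mul] using congrArg (·.map (algebraMap ℂ R)) h
  ybe_d {i j l} hij hil hjl := by
    have h := ybe_relabel hYBDB hij hil hjl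
    have h := ybe_ptrans_left h hil hjl (.inl rfl) (.inr rfl) hij
    have h := ybe_inv h ((Matrix.isUnit_transpose D).2 hD) hB hij hjl hil
    have h := ybe_ptrans_right h hil hjl hjl hil hij.symm
    simpa only [Matrix.map_mul] using congrArg (·.map (algebraMap ℂ R)) h

end DualExchange

/-- fusion of the dual exchange relation. -/
theorem fused_dual_exchange {n : ℕ} (hn : 1 ≤ n)
    {R : Type*} [Ring R] [Algebra ℂ R]
    (A B C D : M2 n ℂ)
    (hYBA : emb2 (ι := Fin 3) A 0 1 * emb2 A 0 2 * emb2 A 1 2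
          = emb2 A 1 2 * emb2 A 0 2 * emb2 A 0 1)
    (hYBAC : emb2 (ι := Fin 3) A 0 1 * emb2 C 0 2 * emb2 C 1 2
          = emb2 C 1 2 * emb2 C 0 2 * emb2 A 0 1)
    (hYBD : emb2 (ι := Fin 3) D 0 1 * emb2 D 0 2 * emb2 D 1 2
          = emb2 D 1 2 * emb2 D 0 2 * emb2 D 0 1)
    (hYBDB : emb2 (ι := Fin 3) D 0 1 * emb2 B 0 2 * emb2 B 1 2
          = emb2 B 1 2 * emb2 B 0 2 * emb2 D 0 1)
    (hUA : A * perm2 A = 1) (hUD : D * perm2 D = 1) (hBC : B = perm2 C)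
    (hA : IsUnit A) (hD : IsUnit D) (hB1 : IsUnit (t1 B)) (hC2 : IsUnit (t2 C))
    {ι : Type} [Fintype ι] [DecidableEq ι]
    (hfA : ∀ M N : List ι, OkPair M N → IsUnit (fuse A M N.reverse))
    (hfD : ∀ M N : List ι, OkPair M N → IsUnit (fuse D M N.reverse))
    (hfB : ∀ M N : List ι, OkPair M N → IsUnit (ptrans M.toFinset (fuse B M N)))
    (hfC : ∀ M N : List ι, OkPair M N → IsUnit (ptrans N.toFinset (fuse C M N)))
    (K : Matrix (Fin n) (Fin n) R)
    (hK : (emb2 (ι := Fin 2) (A⁻¹)ᵀ 0 1).map (algebraMap ℂ R) * emb1 K 0 *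
            (emb2 (t2 ((t1 B)⁻¹)) 0 1).map (algebraMap ℂ R) * emb1 K 1
        = emb1 K 1 * (emb2 (t1 ((t2 C)⁻¹)) 0 1).map (algebraMap ℂ R) * emb1 K 0 *
            (emb2 (Dᵀ)⁻¹ 0 1).map (algebraMap ℂ R))
    (M N : List ι) (hMN : OkPair M N) :
    (ptrans N.toFinset (ptrans M.toFinset ((fuse A M N.reverse)⁻¹))).map (algebraMap ℂ R) *
      fuseT (t2 ((t1 B)⁻¹)) K M *
      (ptrans N.toFinset ((ptrans M.toFinset (fuse B M N))⁻¹)).map (algebraMap ℂ R) *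
      fuseT (t2 ((t1 B)⁻¹)) K N
    = fuseT (t2 ((t1 B)⁻¹)) K N *
      (ptrans M.toFinset ((ptrans N.toFinset (fuse C M N))⁻¹)).map (algebraMap ℂ R) *
      fuseT (t2 ((t1 B)⁻¹)) K M *
      ((ptrans N.toFinset (ptrans M.toFinset (fuse D M N.reverse)))⁻¹).map (algebraMap ℂ R) := by
  obtain ⟨hM, hN, hd⟩ := hMN
  have H := exchangeData_dual (ι := ι) hYBAC hYBDB hBC hA hD hB1 hC2 hK
  have hC : (fuse (t1 ((t2 C)⁻¹)) M N).map (algebraMap ℂ R) =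
      (fuse (t2 ((t1 B)⁻¹)) N M).map (algebraMap ℂ R) := by
    rw [t1_inv_t2_perm2, ← hBC, map_fuse, map_fuse, H.gridProd_swap _ hN hM hd.symm]
    simp only [emb2_perm2]
  rw [fuse_dual_A hA hd, fuse_dual_B hB1 hM hN hd, fuse_dual_C hC2 hM hN hd, fuse_dual_D hD hd,
    hC]
  simp only [map_fuse, fuseT_eq_solProd]
  exact H.exchange_grid hM hN hd

end QT
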